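/- arXiv:2211.16459 — 2 statements merged into one kernel-verified Lean document; each statement's English description precedes it below -/
import Mathlib

section
/- For every set of triplets T on [n], the AddS3 similarities sum to zero over all pairs: Σ_{1≤i<j≤n} s^{AddS3}_{ij} = 0. Consequently, for any hierarchy H, Dasgupta's revenue Drev(H, s^{AddS3}) = n·Σ_{i<j} s^{AddS3}_{ij} − Dcost(H, s^{AddS3}) equals − Dcost(H, s^{AddS3}). -/
open Finset MeasureTheory

namespace CompHC

/-- A rooted binary tree with leaves labelled by elements of `Fin n`. -/
inductive HTree (n : ℕ) : Type
  | leaf (i : Fin n) : HTree n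
  | node (l r : HTree n) : HTree n

namespace HTree

/-- The list of leaf labels of a tree. -/
def leaves {n : ℕ} : HTree n → List (Fin n)
  | .leaf i => [i]
  | .node l r => l.leaves ++ r.leaves

/-- The number of leaves of a tree. -/
def size {n : ℕ} (t : HTree n) : ℕ := t.leaves.length

/-- `|H(i ∨ j)|`: the number of leaves of the smallest subtree containing both `i` and `j`. -/
def lcaSize {n : ℕ} : HTree n → Fin n → Fin n → ℕ
  | .leaf _, _, _ => 1
  | .node l r, i, j =>
      if i ∈ l.leaves ∧ j ∈ l.leaves then l.lcaSize i j
      else if i ∈ r.leaves ∧ j ∈ r.leaves then r.lcaSize i j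
      else l.size + r.size

/-- Sum of `f |N1| |N2|` over the internal nodes `N` of the tree, `N1, N2` its children. -/
def internalSum {n : ℕ} (f : ℕ → ℕ → ℕ) : HTree n → ℕ
  | .leaf _ => 0
  | .node l r => f l.size r.size + l.internalSum f + r.internalSum f

end HTree

/-- A hierarchy on `[n]`: every object appears exactly once as a leaf. -/
def IsHierarchy {n : ℕ} (t : HTree n) : Prop :=
  t.leaves.Nodup ∧ ∀ i : Fin n, i ∈ t.leaves

abbrev Triplet (n : ℕ) := Fin n × Fin n × Fin n
abbrev Quadruplet (n : ℕ) := Fin n × Fin n × Fin n × Fin n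

/-- The entries of a triplet are pairwise distinct. -/
def distinctTriplet {n : ℕ} (t : Triplet n) : Prop :=
  t.1 ≠ t.2.1 ∧ t.1 ≠ t.2.2 ∧ t.2.1 ≠ t.2.2

/-- A quadruplet `(i,j,k,l)` satisfies `i<j`, `k<l`, `(i,j) ≠ (k,l)`. -/
def validQuadruplet {n : ℕ} (q : Quadruplet n) : Prop :=
  q.1 < q.2.1 ∧ q.2.2.1 < q.2.2.2 ∧ (q.1, q.2.1) ≠ (q.2.2.1, q.2.2.2)

/-- Triplet revenue `Trev(H,T) = Σ_{(i,j,k)∈T} (|H(i∨k)| − |H(i∨j)|)`. -/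
def Trev {n : ℕ} (H : HTree n) (T : Finset (Triplet n)) : ℤ :=
  ∑ t ∈ T, ((H.lcaSize t.1 t.2.2 : ℤ) - (H.lcaSize t.1 t.2.1 : ℤ))

/-- Quadruplet revenue `Qrev(H,Q) = Σ_{(i,j,k,l)∈Q} (|H(k∨l)| − |H(i∨j)|)`. -/
def Qrev {n : ℕ} (H : HTree n) (Q : Finset (Quadruplet n)) : ℤ :=
  ∑ q ∈ Q, ((H.lcaSize q.2.2.1 q.2.2.2 : ℤ) - (H.lcaSize q.1 q.2.1 : ℤ))

/-- The set of pairs `(i,j)` with `i < j`. -/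
def pairs (n : ℕ) : Finset (Fin n × Fin n) :=
  Finset.univ.filter fun p => p.1 < p.2

/-- Dasgupta's cost `Dcost(H,s) = Σ_{i<j} s_{ij}·|H(i∨j)|`. -/
noncomputable def Dcost {n : ℕ} (H : HTree n) (s : Fin n → Fin n → ℝ) : ℝ :=
  ∑ p ∈ pairs n, s p.1 p.2 * (H.lcaSize p.1 p.2 : ℝ)

/-- The AddS3 similarity computed from a triplet set. -/
def sAddS3 {n : ℕ} (T : Finset (Triplet n)) (i j : Fin n) : ℤ :=
  ∑ k ∈ Finset.univ.filter (fun k : Fin n => k ≠ i ∧ k ≠ j),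
    (((if (i, j, k) ∈ T then 1 else 0) - (if (i, k, j) ∈ T then 1 else 0)
      + (if (j, i, k) ∈ T then 1 else 0) - (if (j, k, i) ∈ T then 1 else 0) : ℤ))

/-- The AddS4 similarity computed from a quadruplet set. -/
def sAddS4 {n : ℕ} (Q : Finset (Quadruplet n)) (i j : Fin n) : ℤ :=
  ∑ p ∈ (pairs n).filter (fun p => p ≠ (i, j)),
    (((if (i, j, p.1, p.2) ∈ Q then 1 else 0)
      - (if (p.1, p.2, i, j) ∈ Q then 1 else 0) : ℤ))

/-- The triplet set induced by a hierarchy `H0`: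
`T0 = {(i,j,k) : i,j,k pairwise distinct, |H0(i∨j)| < min(|H0(i∨k)|, |H0(j∨k)|)}`. -/
def inducedTriplets {n : ℕ} (H : HTree n) : Finset (Triplet n) :=
  Finset.univ.filter fun t : Triplet n =>
    t.1 ≠ t.2.1 ∧ t.1 ≠ t.2.2 ∧ t.2.1 ≠ t.2.2 ∧
    H.lcaSize t.1 t.2.1 < min (H.lcaSize t.1 t.2.2) (H.lcaSize t.2.1 t.2.2)


/-- Summing `F i j + F j i` over `i < j` is the full double sum, if `F` vanishes on the diagonal. -/
lemma sum_pairs_add_swap {n : ℕ} (F : Fin n → Fin n → ℤ) (hF : ∀ i, F i i = 0) :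
    ∑ p ∈ pairs n, (F p.1 p.2 + F p.2 p.1) = ∑ i, ∑ j, F i j := by
  have hsplit : ∀ i j, F i j = (if i < j then F i j else 0) + if j < i then F i j else 0 := by
    intro i j
    rcases lt_trichotomy i j with h | h | h
    · simp [h, h.not_gt]
    · simp [h, hF]
    · simp [h, h.not_gt]
  have hpairs : ∀ G : Fin n → Fin n → ℤ,
      ∑ p ∈ pairs n, G p.1 p.2 = ∑ i, ∑ j, if i < j then G i j else 0 := by
    intro G
    rw [pairs, Finset.sum_filter, Fintype.sum_prod_type]
  rw [Finset.sum_add_distrib, hpairs F, hpairs fun i j => F j i]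
  conv_rhs => enter [2, i, 2, j]; rw [hsplit i j]
  simp only [Finset.sum_add_distrib]
  congr 1
  exact Finset.sum_comm

lemma sum_pairs_sAddS3 {n : ℕ} (T : Finset (Triplet n)) :
    ∑ p ∈ pairs n, sAddS3 T p.1 p.2 = 0 := by
  let a : Fin n → Fin n → Fin n → ℤ := fun i j k =>
    if i ≠ j ∧ k ≠ i ∧ k ≠ j then
      (if (i, j, k) ∈ T then 1 else 0) - (if (i, k, j) ∈ T then 1 else 0) else 0
  have hanti : ∀ i j k, a i j k = -a i k j := by
    intro i j k
    simp only [a]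
    split_ifs <;> first | rfl | (exfalso; tauto)
  have hs : ∀ p ∈ pairs n, sAddS3 T p.1 p.2 = ∑ k, a p.1 p.2 k + ∑ k, a p.2 p.1 k := by
    rintro ⟨i, j⟩ hp
    have hij : i ≠ j := (Finset.mem_filter.mp hp).2.ne
    rw [sAddS3, Finset.sum_filter, ← Finset.sum_add_distrib]
    refine Finset.sum_congr rfl fun k _ => ?_
    by_cases hk : k ≠ i ∧ k ≠ j
    · simp only [a, if_pos hk, if_pos (And.intro hij hk), if_pos (And.intro hij.symm hk.symm)]
      ring
    · rw [if_neg hk]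
      simp only [a]
      rw [if_neg fun h => hk h.2, if_neg fun h => hk h.2.symm, add_zero]
  rw [Finset.sum_congr rfl hs, sum_pairs_add_swap (fun i j => ∑ k, a i j k) (by simp [a])]
  refine Finset.sum_eq_zero fun i _ => ?_
  have h : ∑ j, ∑ k, a i j k = -∑ j, ∑ k, a i j k := by
    conv_lhs => rw [Finset.sum_comm]
    simp only [← Finset.sum_neg_distrib]
    exact Finset.sum_congr rfl fun j _ => Finset.sum_congr rfl fun k _ => hanti i k j
  lia

/-- The AddS3 similarities sum to zero over all pairs; consequently Dasgupta's
revenue `Drev(H, s^{AddS3}) = n·Σ_{i<j} s_{ij} − Dcost(H, s^{AddS3})` equals `−Dcost(H, s^{AddS3})`. -/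
theorem sAddS3_sum_zero {n : ℕ} (T : Finset (Triplet n))
    (hT : ∀ t ∈ T, distinctTriplet t) :
    (∑ p ∈ pairs n, sAddS3 T p.1 p.2) = 0 ∧
    ∀ H : HTree n, IsHierarchy H →
      (n : ℝ) * (∑ p ∈ pairs n, (sAddS3 T p.1 p.2 : ℝ)) -
          Dcost H (fun i j => (sAddS3 T i j : ℝ)) =
        - Dcost H (fun i j => (sAddS3 T i j : ℝ)) := by
  refine ⟨sum_pairs_sAddS3 T, fun H _ => ?_⟩
  rw [← Int.cast_sum, sum_pairs_sAddS3, Int.cast_zero, mul_zero, zero_sub]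

end CompHC
end

section
/- For every hierarchy H on n objects, Σ_{1≤i<j≤n} |H(i∨j)| = (n³ − n)/3. Equivalently, Dasgupta's cost of any hierarchy on [n] with all pairwise similarities equal to 1 is (n³ − n)/3, independent of the tree. -/
open Finset MeasureTheory

namespace CompHC

namespace HTree

theorem card_toFinset_leaves {n : ℕ} {t : HTree n} (ht : t.leaves.Nodup) :
    t.leaves.toFinset.card = t.size :=
  List.toFinset_card_of_nodup ht

theorem lcaSize_comm {n : ℕ} (t : HTree n) (i j : Fin n) : t.lcaSize i j = t.lcaSize j i := by
  induction t with
  | leaf k => rfl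
  | node l r ihl ihr => simp only [lcaSize, ihl, ihr, and_comm]

theorem lcaSize_self {n : ℕ} (t : HTree n) {i : Fin n} (hi : i ∈ t.leaves) :
    t.lcaSize i i = 1 := by
  induction t with
  | leaf k => rfl
  | node l r ihl ihr =>
    simp only [leaves, List.mem_append] at hi
    by_cases hl : i ∈ l.leaves
    · simp [lcaSize, hl, ihl hl]
    · have hr := hi.resolve_left hl
      simp [lcaSize, hl, hr, ihr hr]

/-- Summed over all ordered pairs of leaves of a tree with `m` distinct leaves, the sizes of the
least common ancestors add up to `(2 * m ^ 3 + m) / 3`. -/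
theorem three_mul_sum_sum_lcaSize {n : ℕ} (t : HTree n) (ht : t.leaves.Nodup) :
    3 * ∑ i ∈ t.leaves.toFinset, ∑ j ∈ t.leaves.toFinset, t.lcaSize i j =
      2 * t.size ^ 3 + t.size := by
  induction t with
  | leaf k => simp [leaves, size, lcaSize]
  | node l r ihl ihr =>
    obtain ⟨hl, hr, hlr⟩ := List.nodup_append'.mp ht
    have hdisj : Disjoint l.leaves.toFinset r.leaves.toFinset :=
      List.disjoint_toFinset_iff_disjoint.mpr hlr
    have hll : ∑ i ∈ l.leaves.toFinset, ∑ j ∈ l.leaves.toFinset, (node l r).lcaSize i j =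
        ∑ i ∈ l.leaves.toFinset, ∑ j ∈ l.leaves.toFinset, l.lcaSize i j :=
      sum_congr rfl fun i hi => sum_congr rfl fun j hj => by
        simp only [List.mem_toFinset] at hi hj
        simp [lcaSize, hi, hj]
    have hrr : ∑ i ∈ r.leaves.toFinset, ∑ j ∈ r.leaves.toFinset, (node l r).lcaSize i j =
        ∑ i ∈ r.leaves.toFinset, ∑ j ∈ r.leaves.toFinset, r.lcaSize i j :=
      sum_congr rfl fun i hi => sum_congr rfl fun j hj => by
        simp only [List.mem_toFinset] at hi hj
        have hi' : i ∉ l.leaves := fun h => hlr h hi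
        simp [lcaSize, hi, hj, hi']
    have cross : ∀ i ∈ l.leaves.toFinset, ∀ j ∈ r.leaves.toFinset,
        (node l r).lcaSize i j = l.size + r.size := fun i hi j hj => by
      simp only [List.mem_toFinset] at hi hj
      have hi' : i ∉ r.leaves := hlr hi
      have hj' : j ∉ l.leaves := hlr.symm hj
      simp [lcaSize, hi', hj']
    have hcross_lr : ∑ i ∈ l.leaves.toFinset, ∑ j ∈ r.leaves.toFinset, (node l r).lcaSize i j =
        l.size * (r.size * (l.size + r.size)) := by
      rw [sum_congr rfl fun i hi => sum_congr rfl (cross i hi)]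
      simp [card_toFinset_leaves hl, card_toFinset_leaves hr]
    have hcross_rl : ∑ i ∈ r.leaves.toFinset, ∑ j ∈ l.leaves.toFinset, (node l r).lcaSize i j =
        l.size * (r.size * (l.size + r.size)) := by
      rw [sum_comm, ← hcross_lr]
      exact sum_congr rfl fun i _ => sum_congr rfl fun j _ => lcaSize_comm _ _ _
    have hsize : (node l r).size = l.size + r.size := by simp [size, leaves]
    have hunion : (node l r).leaves.toFinset = l.leaves.toFinset ∪ r.leaves.toFinset := by
      simp [leaves]
    simp only [hunion, sum_union hdisj, sum_add_distrib, hll, hrr, hcross_lr, hcross_rl, hsize]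
    linear_combination ihl hl + ihr hr

end HTree

/-- A symmetric function summed over all of `Fin n × Fin n` is twice its sum over the pairs
`i < j` plus its diagonal. -/
theorem sum_sum_eq_two_mul_sum_pairs_add {n : ℕ} (f : Fin n → Fin n → ℕ)
    (hf : ∀ i j, f i j = f j i) :
    ∑ i, ∑ j, f i j = 2 * ∑ p ∈ pairs n, f p.1 p.2 + ∑ i, f i i := by
  have hpairs : ∑ p ∈ pairs n, f p.1 p.2 = ∑ i, ∑ j, if i < j then f i j else 0 := by
    rw [pairs, sum_filter, Fintype.sum_prod_type]
  have hswap : ∑ p ∈ pairs n, f p.1 p.2 = ∑ i, ∑ j, if j < i then f i j else 0 := by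
    rw [hpairs, sum_comm]
    simp only [hf]
  have hdiag : ∑ i, f i i = ∑ i, ∑ j, if i = j then f i j else 0 := by simp
  rw [two_mul]
  nth_rewrite 1 [hpairs]
  rw [hswap, hdiag]
  simp only [← sum_add_distrib]
  refine sum_congr rfl fun i _ => sum_congr rfl fun j _ => ?_
  rcases lt_trichotomy i j with h | h | h
  · simp [h, h.not_gt, h.ne]
  · simp [h]
  · simp [h, h.not_gt, h.ne']

theorem IsHierarchy.three_mul_sum_pairs_lcaSize {n : ℕ} {H : HTree n} (hH : IsHierarchy H) :
    3 * ∑ p ∈ pairs n, H.lcaSize p.1 p.2 + n = n ^ 3 := by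
  have huniv : H.leaves.toFinset = univ := by
    ext i
    simpa using hH.2 i
  have hsize : H.size = n := by
    rw [← HTree.card_toFinset_leaves hH.1, huniv, card_univ, Fintype.card_fin]
  have hsum := HTree.three_mul_sum_sum_lcaSize H hH.1
  rw [huniv, hsize, sum_sum_eq_two_mul_sum_pairs_add _ H.lcaSize_comm,
    sum_congr rfl fun i _ => H.lcaSize_self (hH.2 i)] at hsum
  simp only [sum_const, card_univ, Fintype.card_fin, smul_eq_mul, mul_one] at hsum
  omega

/-- For every hierarchy `H` on `n` objects, `Σ_{i<j} |H(i∨j)| = (n³ − n)/3`;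
equivalently Dasgupta's cost with all similarities equal to 1 is `(n³ − n)/3`. -/
theorem sum_lcaSize_eq {n : ℕ} (H : HTree n) (hH : IsHierarchy H) :
    (∑ p ∈ pairs n, (H.lcaSize p.1 p.2 : ℚ)) = ((n : ℚ) ^ 3 - n) / 3 ∧
    Dcost H (fun _ _ => 1) = ((n : ℝ) ^ 3 - n) / 3 := by
  have h := hH.three_mul_sum_pairs_lcaSize
  constructor
  · have hq := congrArg (Nat.cast : ℕ → ℚ) h
    push_cast at hq
    linarith
  · have hr := congrArg (Nat.cast : ℕ → ℝ) h
    push_cast at hr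
    simp only [Dcost, one_mul]
    linarith

end CompHC
end
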